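/- Let f and ν satisfy the adapted coordinate conditions at the first-kind singular point p = (0,0) as in the context. Then there exists a C^∞ function K̂ on a neighborhood of p such that K̂(u,v) = v·K(u,v) at every point with v ≠ 0 (where K is the Gaussian curvature), and 2·K̂(u,0) = κ_Π(u) := κ_ν(u)·κ_c(u) for all u near 0, where κ_ν(u) := ⟨f_uu(u,0), ν(u,0)⟩ is the limiting normal curvature and κ_c(u) := det(f_u(u,0), f_vv(u,0), f_vvv(u,0)) is the cuspidal curvature. -/

import Mathlib

open scoped RealInnerProductSpace
open Filter

noncomputable section

/-- Euclidean 3-space. -/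
abbrev E3 : Type := EuclideanSpace ℝ (Fin 3)

/-- Partial derivative in the first (`u`) direction. -/
def pu {E : Type*} [NormedAddCommGroup E] [NormedSpace ℝ E] (f : ℝ × ℝ → E) (q : ℝ × ℝ) : E :=
  fderiv ℝ f q (1, 0)

/-- Partial derivative in the second (`v`) direction. -/
def pv {E : Type*} [NormedAddCommGroup E] [NormedSpace ℝ E] (f : ℝ × ℝ → E) (q : ℝ × ℝ) : E :=
  fderiv ℝ f q (0, 1)

/-- Determinant of three column vectors in `ℝ³`. -/
def det3 (a b c : E3) : ℝ :=
  Matrix.det !![a 0, b 0, c 0; a 1, b 1, c 1; a 2, b 2, c 2]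

/-- Cross product in `ℝ³`. -/
def cross3 (a b : E3) : E3 :=
  (WithLp.equiv 2 (Fin 3 → ℝ)).symm
    ![a 1 * b 2 - a 2 * b 1, a 2 * b 0 - a 0 * b 2, a 0 * b 1 - a 1 * b 0]

/-- Coefficients of the first fundamental form. -/
def Ec (f : ℝ × ℝ → E3) (q : ℝ × ℝ) : ℝ := ⟪pu f q, pu f q⟫
def Fc (f : ℝ × ℝ → E3) (q : ℝ × ℝ) : ℝ := ⟪pu f q, pv f q⟫
def Gc (f : ℝ × ℝ → E3) (q : ℝ × ℝ) : ℝ := ⟪pv f q, pv f q⟫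

/-- Coefficients of the second fundamental form. -/
def Lc (f ν : ℝ × ℝ → E3) (q : ℝ × ℝ) : ℝ := ⟪pu (pu f) q, ν q⟫
def Mc (f ν : ℝ × ℝ → E3) (q : ℝ × ℝ) : ℝ := ⟪pv (pu f) q, ν q⟫
def Nc (f ν : ℝ × ℝ → E3) (q : ℝ × ℝ) : ℝ := ⟪pv (pv f) q, ν q⟫

/-- The mean curvature `H = (E N − 2 F M + G L)/(2(E G − F²))`. -/
def meanCurv (f ν : ℝ × ℝ → E3) (q : ℝ × ℝ) : ℝ :=
  (Ec f q * Nc f ν q - 2 * Fc f q * Mc f ν q + Gc f q * Lc f ν q) /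
    (2 * (Ec f q * Gc f q - Fc f q ^ 2))

/-- The Gaussian curvature `K = (L N − M²)/(E G − F²)`. -/
def gaussCurv (f ν : ℝ × ℝ → E3) (q : ℝ × ℝ) : ℝ :=
  (Lc f ν q * Nc f ν q - Mc f ν q ^ 2) / (Ec f q * Gc f q - Fc f q ^ 2)

/-- Differentiation under the integral sign over a compact interval, for a `C¹` integrand. -/
theorem hasFDerivAt_intervalIntegral_of_contDiff {H E : Type*} [NormedAddCommGroup H]
    [NormedSpace ℝ H] [ProperSpace H] [NormedAddCommGroup E] [NormedSpace ℝ E]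
    {Φ : H × ℝ → E} (hΦ : ContDiff ℝ 1 Φ) (a b : ℝ) (x : H) :
    HasFDerivAt (fun x => ∫ t in a..b, Φ (x, t))
      (∫ t in a..b, (fderiv ℝ Φ (x, t)).comp (ContinuousLinearMap.inl ℝ H ℝ)) x := by
  have hcont : Continuous fun p : H × ℝ =>
      (fderiv ℝ Φ p).comp (ContinuousLinearMap.inl ℝ H ℝ) :=
    (hΦ.continuous_fderiv one_ne_zero).clm_comp continuous_const
  have hΦc := hΦ.continuous
  obtain ⟨C, hC⟩ := ((isCompact_closedBall x 1).prod
    (isCompact_uIcc (a := a) (b := b))).exists_bound_of_continuousOn hcont.continuousOn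
  refine intervalIntegral.hasFDerivAt_integral_of_dominated_of_fderiv_le
    (F := fun x t => Φ (x, t)) (bound := fun _ => C)
    (F' := fun x t => (fderiv ℝ Φ (x, t)).comp (ContinuousLinearMap.inl ℝ H ℝ))
    (Metric.closedBall_mem_nhds x one_pos) ?_ ?_ ?_ ?_ ?_ ?_
  · exact Eventually.of_forall fun y =>
      (hΦc.comp (Continuous.prodMk_right y)).aestronglyMeasurable
  · exact (hΦc.comp (Continuous.prodMk_right x)).intervalIntegrable _ _
  · exact (hcont.comp (Continuous.prodMk_right x)).aestronglyMeasurable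
  · exact Eventually.of_forall fun t ht y hy => hC (y, t) ⟨hy, Set.uIoc_subset_uIcc ht⟩
  · exact intervalIntegrable_const
  · exact Eventually.of_forall fun t _ y _ =>
      ((hΦ.differentiable one_ne_zero) (y, t)).hasFDerivAt.comp y (hasFDerivAt_prodMk_left y t)

/-- The integral over a compact interval of a `Cⁿ` function of parameter and variable is `Cⁿ` in
the parameter. -/
theorem contDiff_nat_intervalIntegral {H : Type} [NormedAddCommGroup H] [NormedSpace ℝ H]
    [ProperSpace H] (a b : ℝ) (n : ℕ) :
    ∀ {E : Type} [NormedAddCommGroup E] [NormedSpace ℝ E] {Φ : H × ℝ → E},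
      ContDiff ℝ n Φ → ContDiff ℝ n (fun x => ∫ t in a..b, Φ (x, t)) := by
  induction n with
  | zero =>
    intro E _ _ Φ hΦ
    rw [Nat.cast_zero, contDiff_zero] at hΦ ⊢
    exact intervalIntegral.continuous_parametric_intervalIntegral_of_continuous'
      (f := fun x t => Φ (x, t)) hΦ a b
  | succ n ih =>
    intro E _ _ Φ hΦ
    push_cast at hΦ ⊢
    rw [contDiff_succ_iff_hasFDerivAt]
    refine ⟨_, ?_, hasFDerivAt_intervalIntegral_of_contDiff (hΦ.of_le le_add_self) a b⟩
    exact ih (Φ := fun p => (fderiv ℝ Φ p).comp (ContinuousLinearMap.inl ℝ H ℝ))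
      ((hΦ.fderiv_right le_rfl).clm_comp contDiff_const)

theorem contDiff_intervalIntegral {H E : Type} [NormedAddCommGroup H] [NormedSpace ℝ H]
    [ProperSpace H] [NormedAddCommGroup E] [NormedSpace ℝ E] {Φ : H × ℝ → E}
    (hΦ : ContDiff ℝ (⊤ : ℕ∞) Φ) (a b : ℝ) :
    ContDiff ℝ (⊤ : ℕ∞) (fun x => ∫ t in a..b, Φ (x, t)) :=
  contDiff_infty.2 fun n => contDiff_nat_intervalIntegral a b n (contDiff_infty.1 hΦ n)

section PartialDerivatives

variable {E : Type} [NormedAddCommGroup E] [NormedSpace ℝ E] {g h : ℝ × ℝ → E}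

theorem contDiff_pu (hg : ContDiff ℝ (⊤ : ℕ∞) g) : ContDiff ℝ (⊤ : ℕ∞) (pu g) :=
  (hg.fderiv_right (m := (⊤ : ℕ∞)) le_rfl).clm_apply contDiff_const

theorem contDiff_pv (hg : ContDiff ℝ (⊤ : ℕ∞) g) : ContDiff ℝ (⊤ : ℕ∞) (pv g) :=
  (hg.fderiv_right (m := (⊤ : ℕ∞)) le_rfl).clm_apply contDiff_const

/-- Hadamard's lemma: division of `g - g(·, 0)` by the second coordinate. -/
theorem exists_contDiff_eq_add_snd_smul [CompleteSpace E] (hg : ContDiff ℝ (⊤ : ℕ∞) g) :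
    ∃ h : ℝ × ℝ → E, ContDiff ℝ (⊤ : ℕ∞) h ∧ ∀ q, g q = g (q.1, 0) + q.2 • h q := by
  have hpv := contDiff_pv hg
  refine ⟨fun q => ∫ t in (0 : ℝ)..1, pv g (q.1, t * q.2), ?_, fun q => ?_⟩
  · exact contDiff_intervalIntegral
      (Φ := fun p : (ℝ × ℝ) × ℝ => pv g (p.1.1, p.2 * p.1.2)) (hpv.comp (by fun_prop)) 0 1
  · have hderiv (t : ℝ) : HasDerivAt (fun t : ℝ => g (q.1, t * q.2))
        (q.2 • pv g (q.1, t * q.2)) t := by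
      have h1 : HasDerivAt (fun t : ℝ => (q.1, t * q.2)) (0, q.2) t := by
        simpa using (hasDerivAt_const t q.1).prodMk ((hasDerivAt_id t).mul_const q.2)
      have h2 := ((hg.differentiable (by simp)) (q.1, t * q.2)).hasFDerivAt.comp_hasDerivAt t h1
      have h3 : ((0, q.2) : ℝ × ℝ) = q.2 • (0, 1) := by simp
      rwa [h3, map_smul] at h2
    have hint := intervalIntegral.integral_eq_sub_of_hasDerivAt (a := 0) (b := 1)
      (fun t _ => hderiv t) (Continuous.intervalIntegrable
        (continuous_const.smul (hpv.continuous.comp (by fun_prop))) _ _)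
    rw [intervalIntegral.integral_smul] at hint
    rw [hint]
    simp

theorem pu_snd_smul (hh : ContDiff ℝ (⊤ : ℕ∞) h) (q : ℝ × ℝ) :
    pu (fun q => q.2 • h q) q = q.2 • pu h q := by
  have hd : HasFDerivAt (fun q : ℝ × ℝ => q.2 • h q) _ q :=
    hasFDerivAt_snd.smul ((hh.differentiable (by simp)) q).hasFDerivAt
  simp [pu, hd.fderiv]

theorem pv_snd_smul (hh : ContDiff ℝ (⊤ : ℕ∞) h) (q : ℝ × ℝ) :
    pv (fun q => q.2 • h q) q = h q + q.2 • pv h q := by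
  have hd : HasFDerivAt (fun q : ℝ × ℝ => q.2 • h q) _ q :=
    hasFDerivAt_snd.smul ((hh.differentiable (by simp)) q).hasFDerivAt
  simp [pv, hd.fderiv, add_comm]

theorem pv_add (hg : ContDiff ℝ (⊤ : ℕ∞) g) (hh : ContDiff ℝ (⊤ : ℕ∞) h) (q : ℝ × ℝ) :
    pv (fun q => g q + h q) q = pv g q + pv h q := by
  have hd : HasFDerivAt (fun q => g q + h q) _ q :=
    ((hg.differentiable (by simp)) q).hasFDerivAt.add
      ((hh.differentiable (by simp)) q).hasFDerivAt
  simp [pv, hd.fderiv]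

theorem pu_congr {q : ℝ × ℝ} (hgh : g =ᶠ[nhds q] h) : pu g q = pu h q := by
  simp [pu, hgh.fderiv_eq]

theorem pv_congr {q : ℝ × ℝ} (hgh : g =ᶠ[nhds q] h) : pv g q = pv h q := by
  simp [pv, hgh.fderiv_eq]

theorem pv_pu_eq_pu_pv (hg : ContDiff ℝ (⊤ : ℕ∞) g) (q : ℝ × ℝ) :
    pv (pu g) q = pu (pv g) q := by
  have hd : DifferentiableAt ℝ (fderiv ℝ g) q :=
    (hg.fderiv_right (m := (⊤ : ℕ∞)) le_rfl).differentiable (by simp) q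
  have hsymm : IsSymmSndFDerivAt ℝ g q :=
    (contDiff_infty.1 hg 2).contDiffAt.isSymmSndFDerivAt (by simp)
  have key (w w' : ℝ × ℝ) :
      fderiv ℝ (fun p => fderiv ℝ g p w) q w' = fderiv ℝ (fderiv ℝ g) q w' w := by
    have := hd.hasFDerivAt.clm_apply (hasFDerivAt_const w q)
    simp [this.fderiv]
  unfold pu pv
  rw [key, key, hsymm.eq]

end PartialDerivatives

theorem inner_cross3_eq_det3 (a b c : E3) : ⟪c, cross3 a b⟫ = det3 a b c := by
  simp [cross3, det3, Matrix.det_fin_three, PiLp.inner_apply, Fin.sum_univ_three]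
  ring

theorem det3_smul_right (a b c : E3) (r : ℝ) : det3 a b (r • c) = r * det3 a b c := by
  simp [det3, Matrix.det_fin_three]
  ring

/-- In adapted coordinates at a singular point of the first kind, `v·K` extends to a smooth
function `K̂`, and along the singular curve `2 K̂(u,0)` equals the product curvature
`κ_Π(u) = κ_ν(u)·κ_c(u)`, where `κ_ν(u) = ⟨f_uu, ν⟩(u,0)` and
`κ_c(u) = det(f_u, f_vv, f_vvv)(u,0)`. -/
theorem gauss_curvature_times_v_extends_and_equals_product_curvature
    (f ν : ℝ × ℝ → E3)
    (hf : ContDiff ℝ (⊤ : ℕ∞) f) (hν : ContDiff ℝ (⊤ : ℕ∞) ν)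
    (hfrontal : ∀ q : ℝ × ℝ, ‖ν q‖ = 1 ∧ ⟪ν q, pu f q⟫ = 0 ∧ ⟪ν q, pv f q⟫ = 0)
    (hadapted : ∀ᶠ u in nhds (0 : ℝ),
      pv f (u, 0) = 0 ∧ ‖pu f (u, 0)‖ = 1 ∧
      ⟪pu f (u, 0), pv (pv f) (u, 0)⟫ = 0 ∧ ‖pv (pv f) (u, 0)‖ = 1 ∧
      ν (u, 0) = cross3 (pu f (u, 0)) (pv (pv f) (u, 0)))
    (hreg : ∀ᶠ q in nhds ((0, 0) : ℝ × ℝ), q.2 ≠ 0 → Ec f q * Gc f q - Fc f q ^ 2 ≠ 0) :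
    ∃ (W : Set (ℝ × ℝ)) (Khat : ℝ × ℝ → ℝ), IsOpen W ∧ (0, 0) ∈ W ∧
      ContDiffOn ℝ (⊤ : ℕ∞) Khat W ∧
      (∀ q ∈ W, q.2 ≠ 0 → Khat q = q.2 * gaussCurv f ν q) ∧
      (∀ u : ℝ, (u, 0) ∈ W →
        2 * Khat (u, 0) =
          ⟪pu (pu f) (u, 0), ν (u, 0)⟫ *
            det3 (pu f (u, 0)) (pv (pv f) (u, 0)) (pv (pv (pv f)) (u, 0))) := by
  obtain ⟨h, hh, hdiv⟩ := exists_contDiff_eq_add_snd_smul (contDiff_pv hf)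
  obtain ⟨U, hU, hUo, hU0⟩ := eventually_nhds_iff.1 hadapted
  have hpuf := contDiff_pu hf
  have hpvh := contDiff_pv hh
  set D : ℝ × ℝ → ℝ := fun q => ⟪pu f q, pu f q⟫ * ⟪h q, h q⟫ - ⟪pu f q, h q⟫ ^ 2 with hD
  set P : ℝ × ℝ → ℝ := fun q => ⟪pu (pu f) q, ν q⟫ * ⟪pv h q, ν q⟫ - q.2 * ⟪pu h q, ν q⟫ ^ 2
    with hP
  have hDs : ContDiff ℝ (⊤ : ℕ∞) D :=
    ((hpuf.inner ℝ hpuf).mul (hh.inner ℝ hh)).sub ((hpuf.inner ℝ hh).pow 2)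
  have hPs : ContDiff ℝ (⊤ : ℕ∞) P :=
    (((contDiff_pu hpuf).inner ℝ hν).mul (hpvh.inner ℝ hν)).sub
      (contDiff_snd.mul (((contDiff_pu hh).inner ℝ hν).pow 2))
  have hV : IsOpen (Prod.fst ⁻¹' U : Set (ℝ × ℝ)) := hUo.preimage continuous_fst
  have hfv (q : ℝ × ℝ) (hq : q.1 ∈ U) : pv f q = q.2 • h q := by
    rw [hdiv q, (hU _ hq).1, zero_add]
  have hfv_nhds (q : ℝ × ℝ) (hq : q.1 ∈ U) : pv f =ᶠ[nhds q] fun q => q.2 • h q :=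
    mem_of_superset (hV.mem_nhds hq) hfv
  have hfvv (q : ℝ × ℝ) (hq : q.1 ∈ U) : pv (pv f) q = h q + q.2 • pv h q := by
    rw [pv_congr (hfv_nhds q hq), pv_snd_smul hh]
  have hfuv (q : ℝ × ℝ) (hq : q.1 ∈ U) : pv (pu f) q = q.2 • pu h q := by
    rw [pv_pu_eq_pu_pv hf, pu_congr (hfv_nhds q hq), pu_snd_smul hh]
  have hfvvv (u : ℝ) (hu : u ∈ U) : pv (pv (pv f)) (u, 0) = (2 : ℝ) • pv h (u, 0) := by
    have hev : pv (pv f) =ᶠ[nhds (u, 0)] fun q => h q + q.2 • pv h q :=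
      mem_of_superset (hV.mem_nhds (x := (u, 0)) hu) hfvv
    rw [pv_congr hev, pv_add (h := fun q => q.2 • pv h q) hh (contDiff_snd.smul hpvh), pv_snd_smul hpvh, two_smul]
    simp
  have hh0 (u : ℝ) (hu : u ∈ U) : h (u, 0) = pv (pv f) (u, 0) := by
    simp [hfvv (u, 0) hu]
  have hD0 (u : ℝ) (hu : u ∈ U) : D (u, 0) = 1 := by
    obtain ⟨-, h1, h2, h3, -⟩ := hU u hu
    simp only [hD, hh0 u hu, real_inner_self_eq_norm_sq, h1, h2, h3]
    norm_num
  refine ⟨Prod.fst ⁻¹' U ∩ {q | D q ≠ 0}, fun q => P q / D q,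
    hV.inter (isOpen_ne_fun hDs.continuous continuous_const), ⟨hU0, ?_⟩,
    hPs.contDiffOn.div hDs.contDiffOn fun q hq => hq.2, ?_, ?_⟩
  · simp [hD0 0 hU0]
  · rintro q ⟨hqU, hqD⟩ hq
    have hνh : ⟪h q, ν q⟫ = 0 := by
      have := (hfrontal q).2.2
      rw [hfv q hqU, real_inner_smul_right, real_inner_comm] at this
      exact (mul_eq_zero.1 this).resolve_left hq
    have hnum : Lc f ν q * Nc f ν q - Mc f ν q ^ 2 = q.2 * P q := by
      simp only [Lc, Nc, Mc, hP, hfvv q hqU, hfuv q hqU, inner_add_left, real_inner_smul_left, hνh]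
      ring
    have hden : Ec f q * Gc f q - Fc f q ^ 2 = q.2 ^ 2 * D q := by
      simp only [Ec, Gc, Fc, hD, hfv q hqU, real_inner_smul_left, real_inner_smul_right]
      ring
    have hqD' : D q ≠ 0 := hqD
    simp only [gaussCurv, hnum, hden]
    field_simp
  · rintro u ⟨hu, -⟩
    have hu' : u ∈ U := hu
    have hdet := inner_cross3_eq_det3 (pu f (u, 0)) (pv (pv f) (u, 0)) (pv h (u, 0))
    rw [← (hU u hu').2.2.2.2] at hdet
    rw [hfvvv u hu', det3_smul_right, ← hdet]
    simp only [hD0 u hu', hP]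
    ring
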